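/- For any 4×4 correlation matrix A, [per(A)]² ≥ per(A∘Ā), where Ā is the entrywise complex conjugate of A; both sides are nonnegative real numbers. -/

import Mathlib

open ComplexOrder Matrix

section
open Complex
variable {n : Type*} {A : Matrix n n ℂ}

theorem three_cycle_bound (hA : A.PosSemidef) (hdiag : ∀ i, A i i = 1) (i j k : n) :
    normSq (A i j) + normSq (A j k) + normSq (A i k) ≤
      1 + 2 * (A i j * A j k * A k i).re := by
  have h := (hA.submatrix ![i, j, k]).det_nonneg
  rw [det_fin_three] at h
  have h1 := hA.isHermitian.apply i j
  have h2 := hA.isHermitian.apply j k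
  have h3 := hA.isHermitian.apply k i
  have h4 := (Complex.le_def.1 h).1
  simp only [submatrix_apply, cons_val_zero, cons_val_one, cons_val, hdiag, ← h1, ← h2,
    ← h3] at h4 ⊢
  simp [normSq_apply] at h4 ⊢
  linarith

theorem normSq_entry_le_one (hA : A.PosSemidef) (hdiag : ∀ i, A i i = 1) (i j : n) :
    normSq (A i j) ≤ 1 := by
  have h := (hA.submatrix ![i, j]).det_nonneg
  rw [det_fin_two] at h
  have h1 := hA.isHermitian.apply i j
  have h4 := (Complex.le_def.1 h).1
  simp only [submatrix_apply, cons_val_zero, cons_val_one, hdiag, ← h1] at h4 ⊢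
  simp [normSq_apply] at h4 ⊢
  linarith

theorem four_cycle_bound (hA : A.PosSemidef) (hdiag : ∀ i, A i i = 1) (i j k l : n) :
    normSq (A i j) * normSq (A j k) + normSq (A k l) * normSq (A l i)
      - 2 * ((1 - normSq (A i j)) * (1 - normSq (A j k)))
      - 2 * ((1 - normSq (A k l)) * (1 - normSq (A l i))) ≤
      2 * (A i j * A j k * A k l * A l i).re := by
  have h1 := three_cycle_bound hA hdiag i j k
  have h2 := three_cycle_bound hA hdiag k l i
  have h3 := hA.isHermitian.apply k i
  rw [← h3] at h1
  rw [show A i j * A j k * A k l * A l i = (A i j * A j k) * (A k l * A l i) by ring]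
  have e1 : normSq (A i j) * normSq (A j k) = normSq (A i j * A j k) := by simp
  have e2 : normSq (A k l) * normSq (A l i) = normSq (A k l * A l i) := by simp
  have e3 : (1 - normSq (A i j)) * (1 - normSq (A j k)) =
      1 - normSq (A i j) - normSq (A j k) + normSq (A i j * A j k) := by
    simp
    ring
  have e4 : (1 - normSq (A k l)) * (1 - normSq (A l i)) =
      1 - normSq (A k l) - normSq (A l i) + normSq (A k l * A l i) := by
    simp
    ring
  rw [e3, e4, e1, e2]
  generalize A i j * A j k = α at *
  generalize A k l * A l i = β at *
  simp only [← h3] at h1 h2 ⊢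
  generalize A i k = t at *
  simp [normSq_apply] at h1 h2 ⊢
  nlinarith [sq_nonneg (α.re + β.re - 2 * t.re), sq_nonneg (α.im - β.im - 2 * t.im)]
end

set_option maxRecDepth 10000 in
set_option maxHeartbeats 1000000 in
theorem permanent_fin_four {R : Type*} [CommRing R] (A : Matrix (Fin 4) (Fin 4) R) :
    A.permanent =
      A 0 0 * A 1 1 * A 2 2 * A 3 3 + A 0 0 * A 1 1 * A 2 3 * A 3 2
      + A 0 0 * A 1 2 * A 2 1 * A 3 3 + A 0 0 * A 1 2 * A 2 3 * A 3 1
      + A 0 0 * A 1 3 * A 2 1 * A 3 2 + A 0 0 * A 1 3 * A 2 2 * A 3 1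
      + A 0 1 * A 1 0 * A 2 2 * A 3 3 + A 0 1 * A 1 0 * A 2 3 * A 3 2
      + A 0 1 * A 1 2 * A 2 0 * A 3 3 + A 0 1 * A 1 2 * A 2 3 * A 3 0
      + A 0 1 * A 1 3 * A 2 0 * A 3 2 + A 0 1 * A 1 3 * A 2 2 * A 3 0
      + A 0 2 * A 1 0 * A 2 1 * A 3 3 + A 0 2 * A 1 0 * A 2 3 * A 3 1
      + A 0 2 * A 1 1 * A 2 0 * A 3 3 + A 0 2 * A 1 1 * A 2 3 * A 3 0
      + A 0 2 * A 1 3 * A 2 0 * A 3 1 + A 0 2 * A 1 3 * A 2 1 * A 3 0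
      + A 0 3 * A 1 0 * A 2 1 * A 3 2 + A 0 3 * A 1 0 * A 2 2 * A 3 1
      + A 0 3 * A 1 1 * A 2 0 * A 3 2 + A 0 3 * A 1 1 * A 2 2 * A 3 0
      + A 0 3 * A 1 2 * A 2 0 * A 3 1 + A 0 3 * A 1 2 * A 2 1 * A 3 0 := by
  have h (p : Fin 3) (e : Equiv.Perm (Fin 2)) :
      Equiv.Perm.decomposeFin.symm (p, e) 2 = Equiv.swap 0 p (e 1).succ :=
    Equiv.Perm.decomposeFin_symm_apply_succ e p 1
  rw [← permanent_transpose, permanent, Finset.univ_perm_fin_succ, ← Finset.univ_product_univ]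
  simp only [Finset.sum_map, Equiv.toEmbedding_apply, Finset.sum_product, Fin.sum_univ_succ]
  simp [Finset.univ_perm_fin_succ, ← Finset.univ_product_univ, Finset.sum_product,
    Fin.sum_univ_succ, Fin.prod_univ_succ, Equiv.swap_apply_def, h]
  ring

theorem det_fin_four {R : Type*} [CommRing R] (A : Matrix (Fin 4) (Fin 4) R) :
    A.det =
      A 0 0 * A 1 1 * A 2 2 * A 3 3 - A 0 0 * A 1 1 * A 2 3 * A 3 2
      - A 0 0 * A 1 2 * A 2 1 * A 3 3 + A 0 0 * A 1 2 * A 2 3 * A 3 1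
      + A 0 0 * A 1 3 * A 2 1 * A 3 2 - A 0 0 * A 1 3 * A 2 2 * A 3 1
      - A 0 1 * A 1 0 * A 2 2 * A 3 3 + A 0 1 * A 1 0 * A 2 3 * A 3 2
      + A 0 1 * A 1 2 * A 2 0 * A 3 3 - A 0 1 * A 1 2 * A 2 3 * A 3 0
      - A 0 1 * A 1 3 * A 2 0 * A 3 2 + A 0 1 * A 1 3 * A 2 2 * A 3 0
      + A 0 2 * A 1 0 * A 2 1 * A 3 3 - A 0 2 * A 1 0 * A 2 3 * A 3 1
      - A 0 2 * A 1 1 * A 2 0 * A 3 3 + A 0 2 * A 1 1 * A 2 3 * A 3 0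
      + A 0 2 * A 1 3 * A 2 0 * A 3 1 - A 0 2 * A 1 3 * A 2 1 * A 3 0
      - A 0 3 * A 1 0 * A 2 1 * A 3 2 + A 0 3 * A 1 0 * A 2 2 * A 3 1
      + A 0 3 * A 1 1 * A 2 0 * A 3 2 - A 0 3 * A 1 1 * A 2 2 * A 3 0
      - A 0 3 * A 1 2 * A 2 0 * A 3 1 + A 0 3 * A 1 2 * A 2 1 * A 3 0 := by
  rw [det_succ_row_zero]
  simp [Fin.sum_univ_four, det_fin_three, Fin.succAbove, submatrix_apply]
  ring

/-- The permanent is invariant under simultaneous permutation of rows and columns. -/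
theorem permanent_submatrix_equiv {R n : Type*} [CommRing R] [Fintype n] [DecidableEq n]
    (A : Matrix n n R) (σ : Equiv.Perm n) :
    (A.submatrix σ σ).permanent = A.permanent := by
  rw [← permanent_permute_cols σ A, ← permanent_permute_rows σ (A.submatrix σ id),
    submatrix_submatrix]
  rfl

section
open Complex
variable {A : Matrix (Fin 4) (Fin 4) ℂ}

theorem permanent_im_eq_zero (hA : A.PosSemidef) : A.permanent.im = 0 := by
  rw [← conj_eq_iff_im, permanent, map_sum]
  rw [← permanent, ← permanent_transpose, permanent]
  refine Finset.sum_congr rfl fun σ _ => ?_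
  rw [map_prod]
  exact Finset.prod_congr rfl fun i _ => hA.isHermitian.apply _ _

/-- A Lieb inequality: the permanent dominates the product of two block permanents. -/
theorem one_add_mul_one_add_le_permanent (hA : A.PosSemidef) (hdiag : ∀ i, A i i = 1) :
    (1 + normSq (A 0 1)) * (1 + normSq (A 2 3)) ≤ A.permanent.re := by
  have h := ((hA.submatrix ![0, 0, 1, 1]).hadamard
    (hA.transpose.submatrix ![2, 3, 2, 3])).dotProduct_mulVec_nonneg
      ![A 3 1, A 2 1, A 3 0, A 2 0]
  have h0 := (Complex.le_def.1 h).1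
  have hsq := normSq_nonneg (A 0 2 * A 1 3 + A 0 3 * A 1 2)
  rw [permanent_fin_four]
  have h1 := hA.isHermitian.apply 0 1
  have h2 := hA.isHermitian.apply 0 2
  have h3 := hA.isHermitian.apply 0 3
  have h4 := hA.isHermitian.apply 1 2
  have h5 := hA.isHermitian.apply 1 3
  have h6 := hA.isHermitian.apply 2 3
  simp only [dotProduct, mulVec, Fin.sum_univ_four, hadamard_apply, submatrix_apply] at h0
  simp [hdiag, ← h1, ← h2, ← h3, ← h4, ← h5, ← h6,
    normSq_apply] at h0 hsq ⊢
  linarith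

theorem two_mul_sum_normSq_le_permanent (hA : A.PosSemidef) (hdiag : ∀ i, A i i = 1) :
    2 * (normSq (A 1 2) + normSq (A 2 3) + normSq (A 1 3)) ≤ A.permanent.re := by
  have h := ((hA.submatrix ![2, 3, 1, 3, 1, 2]).hadamard
    (hA.submatrix ![3, 2, 3, 1, 2, 1])).dotProduct_mulVec_nonneg
      ![A 0 1, A 0 1, A 0 2, A 0 2, A 0 3, A 0 3]
  have h0 := (Complex.le_def.1 h).1
  have h7 := three_cycle_bound hA hdiag 1 2 3
  rw [permanent_fin_four]
  have h1 := hA.isHermitian.apply 0 1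
  have h2 := hA.isHermitian.apply 0 2
  have h3 := hA.isHermitian.apply 0 3
  have h4 := hA.isHermitian.apply 1 2
  have h5 := hA.isHermitian.apply 1 3
  have h6 := hA.isHermitian.apply 2 3
  simp only [dotProduct, mulVec, Fin.sum_univ_six, hadamard_apply, submatrix_apply] at h0
  simp [hdiag, ← h1, ← h2, ← h3, ← h4, ← h5, ← h6,
    normSq_apply] at h0 h7 ⊢
  linarith

theorem permanent_lower_bound_of_cycles (hA : A.PosSemidef) (hdiag : ∀ i, A i i = 1) :
    10 * (normSq (A 0 1) + normSq (A 2 3) + normSq (A 0 2) + normSq (A 1 3) + normSq (A 0 3)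
      + normSq (A 1 2)) - 24
      - ((normSq (A 0 1) + normSq (A 2 3)) * (normSq (A 0 2) + normSq (A 1 3))
        + (normSq (A 0 1) + normSq (A 2 3)) * (normSq (A 0 3) + normSq (A 1 2))
        + (normSq (A 0 2) + normSq (A 1 3)) * (normSq (A 0 3) + normSq (A 1 2)))
      ≤ A.permanent.re := by
  have h0 := (Complex.le_def.1 hA.det_nonneg).1
  have c1 := four_cycle_bound hA hdiag 0 1 2 3
  have c2 := four_cycle_bound hA hdiag 1 2 3 0
  have c3 := four_cycle_bound hA hdiag 0 2 1 3
  have c4 := four_cycle_bound hA hdiag 2 1 3 0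
  have c5 := four_cycle_bound hA hdiag 0 1 3 2
  have c6 := four_cycle_bound hA hdiag 1 3 2 0
  have h1 := hA.isHermitian.apply 0 1
  have h2 := hA.isHermitian.apply 0 2
  have h3 := hA.isHermitian.apply 0 3
  have h4 := hA.isHermitian.apply 1 2
  have h5 := hA.isHermitian.apply 1 3
  have h6 := hA.isHermitian.apply 2 3
  have key : A.permanent.re = A.det.re
      + 2 * (normSq (A 0 1) + normSq (A 2 3) + normSq (A 0 2) + normSq (A 1 3) + normSq (A 0 3)
      + normSq (A 1 2)) + 4 * ((A 0 1 * A 1 2 * A 2 3 * A 3 0).re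
      + (A 0 2 * A 2 1 * A 1 3 * A 3 0).re
      + (A 0 1 * A 1 3 * A 3 2 * A 2 0).re) := by
    rw [permanent_fin_four, det_fin_four]
    simp [hdiag, ← h1, ← h2, ← h3, ← h4, ← h5, ← h6, normSq_apply]
    ring
  rw [show A 1 2 * A 2 3 * A 3 0 * A 0 1 = A 0 1 * A 1 2 * A 2 3 * A 3 0 by ring] at c2
  rw [show A 2 1 * A 1 3 * A 3 0 * A 0 2 = A 0 2 * A 2 1 * A 1 3 * A 3 0 by ring] at c4
  rw [show A 1 3 * A 3 2 * A 2 0 * A 0 1 = A 0 1 * A 1 3 * A 3 2 * A 2 0 by ring] at c6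
  have e (i j : Fin 4) : normSq (A i j) = normSq (A j i) := by
    rw [← hA.isHermitian.apply i j, Complex.star_def, normSq_conj]
  simp only [e 2 0, e 3 0, e 2 1, e 3 2] at c1 c2 c3 c4 c5 c6
  simp only [zero_re] at h0
  linarith
end

theorem three_variable_bound {u v w p : ℝ} (hu : 0 ≤ u) (hv : 0 ≤ v) (hw : 0 ≤ w)
    (hu2 : u ≤ 2) (hv2 : v ≤ 2) (hw2 : w ≤ 2)
    (hue : u ≤ p - 1) (hve : v ≤ p - 1) (hwe : w ≤ p - 1)
    (hs : u + v + w ≤ p) (h4 : u + v + w ≤ 4) :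
    1 + u ^ 2 + v ^ 2 + w ^ 2 + 2 * (u * v * w) ≤ p ^ 2 := by
  have hamgm : 27 * (u * v * w) ≤ (u + v + w) ^ 3 := by
    nlinarith [mul_nonneg hu (sq_nonneg (v - w)), mul_nonneg hv (sq_nonneg (u - w)),
      mul_nonneg hw (sq_nonneg (u - v)), mul_nonneg hu (sq_nonneg (u - w)),
      mul_nonneg hu (sq_nonneg (u - v)), mul_nonneg hv (sq_nonneg (u - v)),
      mul_nonneg hv (sq_nonneg (v - w)), mul_nonneg hw (sq_nonneg (w - v)),
      mul_nonneg hw (sq_nonneg (w - u))]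
  have hsum {m : ℝ} (h1 : u ≤ m) (h2 : v ≤ m) (h3 : w ≤ m) :
      u ^ 2 + v ^ 2 + w ^ 2 ≤ m * (u + v + w) := by
    nlinarith [mul_nonneg hu (sub_nonneg.2 h1), mul_nonneg hv (sub_nonneg.2 h2),
      mul_nonneg hw (sub_nonneg.2 h3)]
  have hp : 1 ≤ p := by linarith
  have hs0 : 0 ≤ u + v + w := by positivity
  have hcube {m : ℝ} (h : u + v + w ≤ m) : (u + v + w) ^ 3 ≤ m ^ 3 := by gcongr
  rcases le_total p (3 / 2) with h | h
  · have h1 := hsum hue hve hwe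
    have h2 : u * v * w ≤ (p - 1) * (p - 1) * (p - 1) := by gcongr
    nlinarith [mul_nonneg (sub_nonneg.2 hp) (sub_nonneg.2 h),
      mul_nonneg (mul_nonneg (sub_nonneg.2 hp) (sub_nonneg.2 hp)) (sub_nonneg.2 h)]
  rcases le_total p 3 with h' | h'
  · have h1 := hsum hue hve hwe
    have h2 := hcube hs
    have h3 : (p - 1) * (u + v + w) ≤ (p - 1) * p := by gcongr
    nlinarith [mul_nonneg (sub_nonneg.2 h) (sub_nonneg.2 h'),
      mul_nonneg (mul_nonneg (sub_nonneg.2 h) (sub_nonneg.2 h')) (by linarith : (0:ℝ) ≤ p)]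
  have h1 := hsum hu2 hv2 hw2
  rcases le_total p 4 with h'' | h''
  · have h2 := hcube hs
    nlinarith [mul_nonneg (sub_nonneg.2 h') (sub_nonneg.2 h''),
      mul_nonneg (mul_nonneg (sub_nonneg.2 h') (sub_nonneg.2 h'')) (by linarith : (0:ℝ) ≤ p)]
  · have h2 := hcube h4
    nlinarith

theorem six_variable_bound {x₁ y₁ x₂ y₂ x₃ y₃ p : ℝ}
    (hx₁ : 0 ≤ x₁) (hy₁ : 0 ≤ y₁) (hx₂ : 0 ≤ x₂) (hy₂ : 0 ≤ y₂) (hx₃ : 0 ≤ x₃) (hy₃ : 0 ≤ y₃)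
    (hx₁' : x₁ ≤ 1) (hy₁' : y₁ ≤ 1) (hx₂' : x₂ ≤ 1) (hy₂' : y₂ ≤ 1) (hx₃' : x₃ ≤ 1)
    (hy₃' : y₃ ≤ 1)
    (h₁ : (1 + x₁) * (1 + y₁) ≤ p) (h₂ : (1 + x₂) * (1 + y₂) ≤ p)
    (h₃ : (1 + x₃) * (1 + y₃) ≤ p)
    (hs : x₁ + y₁ + x₂ + y₂ + x₃ + y₃ ≤ p)
    (hlarge : 10 * (x₁ + y₁ + x₂ + y₂ + x₃ + y₃) - 24
      - ((x₁ + y₁) * (x₂ + y₂) + (x₁ + y₁) * (x₃ + y₃) + (x₂ + y₂) * (x₃ + y₃)) ≤ p) :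
    1 + (x₁ ^ 2 + y₁ ^ 2 + x₂ ^ 2 + y₂ ^ 2 + x₃ ^ 2 + y₃ ^ 2)
      + (x₁ * y₁ + x₂ * y₂ + x₃ * y₃) ^ 2
      + 2 * (x₁ * x₂ * y₃ + x₁ * y₂ * x₃ + y₁ * x₂ * x₃ + y₁ * y₂ * y₃) ≤ p ^ 2 := by
  have d₁ : 0 ≤ x₁ * y₁ := by positivity
  have d₂ : 0 ≤ x₂ * y₂ := by positivity
  have d₃ : 0 ≤ x₃ * y₃ := by positivity
  have htri : x₁ * x₂ * y₃ + x₁ * y₂ * x₃ + y₁ * x₂ * x₃ + y₁ * y₂ * y₃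
      ≤ (x₁ + y₁) * (x₂ + y₂) * (x₃ + y₃) := by
    have : 0 ≤ x₁ * x₂ * x₃ + x₁ * y₂ * y₃ + y₁ * x₂ * y₃ + y₁ * y₂ * x₃ := by positivity
    nlinarith
  have e₁ : 2 * (x₁ * y₁) ≤ x₁ + y₁ := by nlinarith
  have e₂ : 2 * (x₂ * y₂) ≤ x₂ + y₂ := by nlinarith
  have e₃ : 2 * (x₃ * y₃) ≤ x₃ + y₃ := by nlinarith
  rcases le_total (x₁ + y₁ + x₂ + y₂ + x₃ + y₃) 4 with h4 | h4
  · have hD : (x₁ * y₁ + x₂ * y₂ + x₃ * y₃) ^ 2 ≤ 2 * (x₁ * y₁ + x₂ * y₂ + x₃ * y₃) := by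
      rw [sq]
      gcongr
      linarith
    have := three_variable_bound (u := x₁ + y₁) (v := x₂ + y₂) (w := x₃ + y₃) (p := p)
      (by linarith) (by linarith) (by linarith) (by linarith) (by linarith) (by linarith)
      (by linarith) (by linarith) (by linarith) (by linarith) (by linarith)
    linarith
  · have hp : 6 ≤ p := by
      have hE : 3 * ((x₁ + y₁) * (x₂ + y₂) + (x₁ + y₁) * (x₃ + y₃) + (x₂ + y₂) * (x₃ + y₃))
          ≤ (x₁ + y₁ + x₂ + y₂ + x₃ + y₃) ^ 2 := by
        linarith [sq_nonneg (x₁ + y₁ - x₂ - y₂), sq_nonneg (x₁ + y₁ - x₃ - y₃),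
          sq_nonneg (x₂ + y₂ - x₃ - y₃)]
      have h6 : x₁ + y₁ + x₂ + y₂ + x₃ + y₃ ≤ 6 := by linarith
      linarith [mul_nonneg (sub_nonneg.2 h4) (sub_nonneg.2 h6)]
    have hsq {t : ℝ} (h0 : 0 ≤ t) (h1 : t ≤ 1) : t ^ 2 ≤ 1 := pow_le_one₀ h0 h1
    have hD : (x₁ * y₁ + x₂ * y₂ + x₃ * y₃) ^ 2 ≤ 3 ^ 2 := by
      gcongr; linarith
    have hT : (x₁ + y₁) * (x₂ + y₂) * (x₃ + y₃) ≤ 2 * 2 * 2 := by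
      gcongr <;> linarith
    have hp2 : 6 ^ 2 ≤ p ^ 2 := pow_le_pow_left₀ (by norm_num) hp 2
    linarith [hsq hx₁ hx₁', hsq hx₂ hx₂', hsq hx₃ hx₃', hsq hy₁ hy₁', hsq hy₂ hy₂',
      hsq hy₃ hy₃']

theorem chollet_reduced_4x4 (A : Matrix (Fin 4) (Fin 4) ℂ)
    (hA : A.PosSemidef) (hdiag : ∀ i, A i i = 1) :
    0 ≤ A.permanent ∧ 0 ≤ (A ⊙ A.map (starRingEnd ℂ)).permanent ∧
      (A ⊙ A.map (starRingEnd ℂ)).permanent ≤ A.permanent ^ 2 := by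
  have hlieb (σ : Equiv.Perm (Fin 4)) := one_add_mul_one_add_le_permanent (hA.submatrix σ)
    fun i => hdiag (σ i)
  have htri (σ : Equiv.Perm (Fin 4)) := two_mul_sum_normSq_le_permanent (hA.submatrix σ)
    fun i => hdiag (σ i)
  have hcyc := permanent_lower_bound_of_cycles hA hdiag
  have e (i j : Fin 4) : Complex.normSq (A i j) = Complex.normSq (A j i) := by
    rw [← hA.isHermitian.apply i j, Complex.star_def, Complex.normSq_conj]
  simp only [permanent_submatrix_equiv, submatrix_apply] at hlieb htri
  have l1 := hlieb 1
  have l2 := hlieb (Equiv.swap 1 2)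
  have l3 := hlieb (Equiv.swap 1 3)
  have t0 := htri 1
  have t1 := htri (Equiv.swap 0 1)
  have t2 := htri (Equiv.swap 0 2)
  have t3 := htri (Equiv.swap 0 3)
  simp [Equiv.swap_apply_def] at l1 l2 l3 t0 t1 t2 t3
  simp only [e 1 0, e 2 0, e 2 1] at l1 l2 l3 t0 t1 t2 t3
  have hre : A.permanent = (A.permanent.re : ℂ) :=
    Complex.ext rfl (by simp [permanent_im_eq_zero hA])
  have hle := normSq_entry_le_one hA hdiag
  have hmain := six_variable_bound (Complex.normSq_nonneg (A 0 1)) (Complex.normSq_nonneg (A 2 3))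
    (Complex.normSq_nonneg (A 0 2)) (Complex.normSq_nonneg (A 1 3)) (Complex.normSq_nonneg (A 0 3))
    (Complex.normSq_nonneg (A 1 2)) (hle _ _) (hle _ _) (hle _ _) (hle _ _) (hle _ _) (hle _ _)
    l1 l2 l3 (by linarith) hcyc
  have hX : A ⊙ A.map (starRingEnd ℂ) = (of fun i j => (Complex.normSq (A i j) : ℂ)) := by
    ext i j
    simp [Complex.mul_conj]
  have hperX : (A ⊙ A.map (starRingEnd ℂ)).permanent =
      ((of fun i j => Complex.normSq (A i j)).permanent : ℝ) := by
    rw [hX, permanent, permanent]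
    push_cast
    rfl
  rw [hperX, hre]
  norm_cast
  refine ⟨?_, ?_, ?_⟩
  · linarith [Complex.normSq_nonneg (A 1 2), Complex.normSq_nonneg (A 2 3),
      Complex.normSq_nonneg (A 1 3)]
  · exact Finset.sum_nonneg fun σ _ => Finset.prod_nonneg fun i _ => Complex.normSq_nonneg _
  · refine le_trans (le_of_eq ?_) hmain
    rw [permanent_fin_four]
    simp only [of_apply, hdiag, map_one, e 1 0, e 2 0, e 3 0, e 2 1, e 3 1, e 3 2]
    ring
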